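/- arXiv:2205.06424 — 2 statements merged into one kernel-verified Lean document; each statement's English description precedes it below -/
import Mathlib

section
/- In the Jin–Xin split scheme setup with p ∈ [0,1), let (u^n, v^n) be the iterates obtained by applying the one-step map n times to initial data (u^0, v^0), and let E_0 = Σ_i [(a−b²)(u^0_i)² + (b·u^0_i − v^0_i)²]·Δx. Then Σ_{j=1}^{∞} Σ_i (b·u^j_i − v^j_i)²·Δx ≤ (p²/(1−p²))·E_0; in particular Σ_i (b·u^n_i − v^n_i)²·Δx → 0 as n → ∞. -/
/-- Convection step of the Jin–Xin split scheme on the periodic grid `ZMod X`,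
in characteristic variables `ρ = √a·u + v`, `l = √a·u − v`:
`ρ*_i = (1−ν)ρ_i + νρ_{i−1}`, `l*_i = (1−ν)l_i + νl_{i+1}`,
`u* = (ρ* + l*)/(2√a)`, `v* = (ρ* − l*)/2`. -/
noncomputable def jxConv {X : ℕ} (a ν : ℝ) (w : (ZMod X → ℝ) × (ZMod X → ℝ)) :
    (ZMod X → ℝ) × (ZMod X → ℝ) :=
  let ρ : ZMod X → ℝ := fun i => Real.sqrt a * w.1 i + w.2 i
  let l : ZMod X → ℝ := fun i => Real.sqrt a * w.1 i - w.2 i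
  let ρs : ZMod X → ℝ := fun i => (1 - ν) * ρ i + ν * ρ (i - 1)
  let ls : ZMod X → ℝ := fun i => (1 - ν) * l i + ν * l (i + 1)
  (fun i => (ρs i + ls i) / (2 * Real.sqrt a), fun i => (ρs i - ls i) / 2)

/-- One full step of the deterministic Jin–Xin split scheme: convection step followed
by the relaxation step `u' = u*`, `v' = p·v* + (1−p)·b·u*`. -/
noncomputable def jxStep {X : ℕ} (a b ν p : ℝ) (w : (ZMod X → ℝ) × (ZMod X → ℝ)) :
    (ZMod X → ℝ) × (ZMod X → ℝ) :=
  let ws := jxConv a ν w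
  (ws.1, fun i => p * ws.2 i + (1 - p) * (b * ws.1 i))

/-- Discrete energy `E(u,v) = ∑_i [(a−b²)u_i² + (b·u_i − v_i)²]·Δx`. -/
noncomputable def jxEnergy {X : ℕ} [NeZero X] (a b Δx : ℝ)
    (w : (ZMod X → ℝ) × (ZMod X → ℝ)) : ℝ :=
  ∑ i : ZMod X, ((a - b ^ 2) * (w.1 i) ^ 2 + (b * w.1 i - w.2 i) ^ 2) * Δx

/-- Telescoping: nonnegative terms dominated by the decrements of a nonnegative sequence are
summable, with sum at most a multiple of the first value of that sequence. -/
lemma summable_and_tsum_le_of_le_decrement {f e : ℕ → ℝ} {c : ℝ} (hc : 0 ≤ c)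
    (hf : ∀ n, 0 ≤ f n) (he : ∀ n, 0 ≤ e n) (h : ∀ n, f n ≤ c * (e n - e (n + 1))) :
    Summable f ∧ ∑' n, f n ≤ c * e 0 := by
  have hsum (n : ℕ) : ∑ i ∈ Finset.range n, f i ≤ c * e 0 :=
    calc ∑ i ∈ Finset.range n, f i
        ≤ ∑ i ∈ Finset.range n, c * (e i - e (i + 1)) := Finset.sum_le_sum fun i _ => h i
      _ = c * (e 0 - e n) := by rw [← Finset.mul_sum, Finset.sum_range_sub']
      _ ≤ c * e 0 := by gcongr; linarith [he n]
  exact ⟨summable_of_sum_range_le hf hsum, Real.tsum_le_of_sum_range_le hf hsum⟩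

/-- The energy density is a combination of the squared characteristic variables. -/
lemma jx_density_eq {s : ℝ} (hs : s ≠ 0) (b u v : ℝ) :
    (s ^ 2 - b ^ 2) * u ^ 2 + (b * u - v) ^ 2 =
      (1 - b / s) / 2 * (s * u + v) ^ 2 + (1 + b / s) / 2 * (s * u - v) ^ 2 := by
  field_simp
  ring

lemma sq_convex_comb_le {ν : ℝ} (h0 : 0 ≤ ν) (h1 : ν ≤ 1) (x y : ℝ) :
    ((1 - ν) * x + ν * y) ^ 2 ≤ (1 - ν) * x ^ 2 + ν * y ^ 2 := by
  nlinarith [mul_nonneg (mul_nonneg h0 (sub_nonneg.2 h1)) (sq_nonneg (x - y))]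

lemma sum_sq_convex_comb_le {ι : Type*} [Fintype ι] {ν : ℝ} (h0 : 0 ≤ ν) (h1 : ν ≤ 1)
    (σ : Equiv.Perm ι) (f : ι → ℝ) :
    ∑ i, ((1 - ν) * f i + ν * f (σ i)) ^ 2 ≤ ∑ i, f i ^ 2 :=
  calc ∑ i, ((1 - ν) * f i + ν * f (σ i)) ^ 2
      ≤ ∑ i, ((1 - ν) * f i ^ 2 + ν * f (σ i) ^ 2) :=
        Finset.sum_le_sum fun i _ => sq_convex_comb_le h0 h1 _ _
    _ = ∑ i, f i ^ 2 := by
        rw [Finset.sum_add_distrib, ← Finset.mul_sum, ← Finset.mul_sum,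
          Equiv.sum_comp σ fun i => f i ^ 2]
        ring

lemma jxEnergy_eq {X : ℕ} [NeZero X] {a : ℝ} (ha : 0 < a) (b Δx : ℝ)
    (w : (ZMod X → ℝ) × (ZMod X → ℝ)) :
    jxEnergy a b Δx w =
      ((1 - b / √a) / 2 * ∑ i, (√a * w.1 i + w.2 i) ^ 2 +
        (1 + b / √a) / 2 * ∑ i, (√a * w.1 i - w.2 i) ^ 2) * Δx := by
  have h (i : ZMod X) := jx_density_eq (Real.sqrt_pos.2 ha).ne' b (w.1 i) (w.2 i)
  simp only [Real.sq_sqrt ha.le] at h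
  simp only [jxEnergy, h, ← Finset.sum_mul, Finset.sum_add_distrib, ← Finset.mul_sum]

lemma jxEnergy_nonneg {X : ℕ} [NeZero X] {a b Δx : ℝ} (hab : b ^ 2 ≤ a) (hΔx : 0 ≤ Δx)
    (w : (ZMod X → ℝ) × (ZMod X → ℝ)) : 0 ≤ jxEnergy a b Δx w := by
  have := sub_nonneg.2 hab
  unfold jxEnergy
  positivity

/-- The convection step does not increase the energy. -/
lemma jxEnergy_jxConv_le {X : ℕ} [NeZero X] {a b Δx ν : ℝ} (ha : 0 < a) (hab : b ^ 2 ≤ a)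
    (hΔx : 0 ≤ Δx) (h0 : 0 ≤ ν) (h1 : ν ≤ 1) (w : (ZMod X → ℝ) × (ZMod X → ℝ)) :
    jxEnergy a b Δx (jxConv a ν w) ≤ jxEnergy a b Δx w := by
  have hs : 0 < √a := Real.sqrt_pos.2 ha
  obtain ⟨hlo, hhi⟩ := abs_le.1 (Real.abs_le_sqrt hab)
  have hα : 0 ≤ (1 - b / √a) / 2 := by
    have := (div_le_one hs).2 hhi
    linarith
  have hβ : 0 ≤ (1 + b / √a) / 2 := by
    have : -1 ≤ b / √a := (le_div_iff₀ hs).2 (by linarith)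
    linarith
  rw [jxEnergy_eq ha, jxEnergy_eq ha]
  have hρ (i : ZMod X) : √a * (jxConv a ν w).1 i + (jxConv a ν w).2 i =
      (1 - ν) * (√a * w.1 i + w.2 i) + ν * (√a * w.1 (i - 1) + w.2 (i - 1)) := by
    simp only [jxConv]
    field_simp
    ring
  have hl (i : ZMod X) : √a * (jxConv a ν w).1 i - (jxConv a ν w).2 i =
      (1 - ν) * (√a * w.1 i - w.2 i) + ν * (√a * w.1 (i + 1) - w.2 (i + 1)) := by
    simp only [jxConv]
    field_simp
    ring
  simp only [hρ, hl]
  gcongr ?_ * Δx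
  exact add_le_add
    (mul_le_mul_of_nonneg_left (sum_sq_convex_comb_le h0 h1 (Equiv.subRight 1)
      fun i => √a * w.1 i + w.2 i) hα)
    (mul_le_mul_of_nonneg_left (sum_sq_convex_comb_le h0 h1 (Equiv.addRight 1)
      fun i => √a * w.1 i - w.2 i) hβ)

/-- The relaxation step converts the equilibrium deviation into an energy decrement. -/
lemma jx_deviation_jxStep {X : ℕ} [NeZero X] (a b Δx ν p : ℝ)
    (w : (ZMod X → ℝ) × (ZMod X → ℝ)) :
    (1 - p ^ 2) * ∑ i, (b * (jxStep a b ν p w).1 i - (jxStep a b ν p w).2 i) ^ 2 * Δx =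
      p ^ 2 * (jxEnergy a b Δx (jxConv a ν w) - jxEnergy a b Δx (jxStep a b ν p w)) := by
  simp only [jxEnergy, ← Finset.sum_sub_distrib, Finset.mul_sum, jxStep]
  refine Finset.sum_congr rfl fun i _ => ?_
  ring

/-- **Summability of the local-equilibrium deviation for the deterministic Jin–Xin
split scheme** (Lemma 5.2 / `prop:det-buv`): with relaxation factor `p ∈ [0,1)`,
`∑_{j≥1} ∑_i (b·u^j_i − v^j_i)²·Δx ≤ p²/(1−p²)·E₀`; in particular
`∑_i (b·u^n_i − v^n_i)²·Δx → 0` as `n → ∞`. -/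
theorem jx_equilibrium_decay (X : ℕ) [NeZero X] (Δx : ℝ) (hΔx : 0 < Δx)
    (a b ν p : ℝ) (ha : 0 < a) (hab : b ^ 2 ≤ a)
    (hν : ν ∈ Set.Ioc (0 : ℝ) 1) (hp : p ∈ Set.Ico (0 : ℝ) 1)
    (u0 v0 : ZMod X → ℝ) :
    (∑' j : ℕ, ∑ i : ZMod X,
        (b * ((jxStep a b ν p)^[j + 1] (u0, v0)).1 i -
          ((jxStep a b ν p)^[j + 1] (u0, v0)).2 i) ^ 2 * Δx) ≤
      p ^ 2 / (1 - p ^ 2) * jxEnergy a b Δx (u0, v0) ∧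
    Filter.Tendsto
      (fun n => ∑ i : ZMod X,
        (b * ((jxStep a b ν p)^[n] (u0, v0)).1 i -
          ((jxStep a b ν p)^[n] (u0, v0)).2 i) ^ 2 * Δx)
      Filter.atTop (nhds 0) := by
  have hp2 : 0 < 1 - p ^ 2 := by nlinarith [hp.1, hp.2]
  obtain ⟨hsum, hle⟩ := summable_and_tsum_le_of_le_decrement
    (f := fun j => ∑ i : ZMod X, (b * ((jxStep a b ν p)^[j + 1] (u0, v0)).1 i -
      ((jxStep a b ν p)^[j + 1] (u0, v0)).2 i) ^ 2 * Δx)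
    (e := fun n => jxEnergy a b Δx ((jxStep a b ν p)^[n] (u0, v0)))
    (c := p ^ 2 / (1 - p ^ 2)) (by positivity) (fun n => by positivity)
    (fun n => jxEnergy_nonneg hab hΔx.le _) (fun n => by
      simp only [Function.iterate_succ_apply']
      rw [div_mul_eq_mul_div, le_div_iff₀' hp2, jx_deviation_jxStep]
      gcongr
      exact jxEnergy_jxConv_le ha hab hΔx.le hν.1.le hν.2 _)
  exact ⟨hle, (Filter.tendsto_add_atTop_iff_nat 1).1 hsum.tendsto_atTop_zero⟩
end

section
/- Fix integers X, M ≥ 1 and Δx > 0 with X·Δx = 2, time step Δt > 0, κ = Δt/Δx, final time T = M·Δt. Let u0 : ℝ → ℝ be 2-periodic and twice continuously differentiable with sup|u0''| = C1 < ∞. Let a_0, …, a_{M−1} be reals with 0 < a_n ≤ 2 and a_n·Δt ≤ Δx for all n, let v^M be the periodic upwind solution at time T, and let u(x, T) = u0(x − Δt·Σ_{j<M} a_j) be the exact solution at time T. Then √( Σ_{i ∈ ZMod X} (v^M_i − u(x_i, T))² ) ≤ (2 + 1/κ)·C1·T·√X·Δt. -/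
open Finset

/-- The periodic first-order upwind scheme on the grid `ZMod X` with per-step CFL
numbers `lam n = a_n·Δt/Δx`: `v⁰ = w0`,
`v^{n+1}_i = (1 − lam n)·v^n_i + lam n·v^n_{i−1}` (indices mod `X`). -/
noncomputable def upwind {X : ℕ} (lam : ℕ → ℝ) (w0 : ZMod X → ℝ) : ℕ → ZMod X → ℝ
  | 0 => w0
  | n + 1 => fun i => (1 - lam n) * upwind lam w0 n i + lam n * upwind lam w0 n (i - 1)

/-- Linear interpolation error of a `C²` function with second derivative at most `C`,
obtained from the convexity of `y ↦ C / 2 * y ^ 2 - f y`. -/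
lemma interpolation_sub_le {f : ℝ → ℝ} {C : ℝ} (hf : ContDiff ℝ 2 f)
    (hC : ∀ y, deriv (deriv f) y ≤ C) {l : ℝ} (h0 : 0 ≤ l) (h1 : l ≤ 1) (x h : ℝ) :
    (1 - l) * f x + l * f (x - h) - f (x - l * h) ≤ C / 2 * (l * (1 - l) * h ^ 2) := by
  have hf1 : Differentiable ℝ f := hf.differentiable (by norm_num)
  have hf2 : Differentiable ℝ (deriv f) :=
    ((contDiff_succ_iff_deriv (n := 1)).1 hf).2.2.differentiable (by norm_num)
  have hd (y : ℝ) : HasDerivAt (fun y => C / 2 * y ^ 2 - f y) (C * y - deriv f y) y := by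
    refine (((hasDerivAt_pow 2 y).const_mul (C / 2)).sub (hf1 y).hasDerivAt).congr_deriv ?_
    norm_num
    ring
  have hd' : deriv (fun y => C / 2 * y ^ 2 - f y) = fun y => C * y - deriv f y :=
    funext fun y => (hd y).deriv
  have hdd (y : ℝ) : HasDerivAt (fun y => C * y - deriv f y) (C - deriv (deriv f) y) y := by
    exact (((hasDerivAt_id y).const_mul C).sub (hf2 y).hasDerivAt).congr_deriv (by simp)
  have hconv : ConvexOn ℝ Set.univ (fun y => C / 2 * y ^ 2 - f y) := by
    refine convexOn_univ_of_deriv2_nonneg (fun y => (hd y).differentiableAt) ?_ fun y => ?_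
    · rw [hd']
      exact fun y => (hdd y).differentiableAt
    · simp only [Function.iterate_succ, Function.iterate_zero, Function.comp_apply, id]
      rw [hd', (hdd y).deriv]
      linarith [hC y]
  have key := hconv.2 (Set.mem_univ x) (Set.mem_univ (x - h)) (sub_nonneg.2 h1) h0
    (sub_add_cancel 1 l)
  simp only [smul_eq_mul] at key
  rw [show (1 - l) * x + l * (x - h) = x - l * h by ring] at key
  linear_combination key

/-- Two-sided linear interpolation error of a `C²` function. -/
lemma abs_interpolation_sub_le {f : ℝ → ℝ} {C : ℝ} (hf : ContDiff ℝ 2 f)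
    (hC : ∀ y, |deriv (deriv f) y| ≤ C) {l : ℝ} (h0 : 0 ≤ l) (h1 : l ≤ 1) (x h : ℝ) :
    |(1 - l) * f x + l * f (x - h) - f (x - l * h)| ≤ C / 2 * (l * (1 - l) * h ^ 2) := by
  have hneg (y : ℝ) : deriv (deriv (-f)) y ≤ C := by
    rw [deriv.neg', deriv.fun_neg]
    exact (neg_le_abs _).trans (hC y)
  have h₁ := interpolation_sub_le hf (fun y => (le_abs_self _).trans (hC y)) h0 h1 x h
  have h₂ := interpolation_sub_le hf.neg hneg h0 h1 x h
  exact abs_le.2 ⟨by linarith, h₁⟩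

/-- On a periodic grid, moving one index down shifts the grid point by one mesh width,
up to a period. -/
lemma Function.Periodic.apply_grid_sub_one {X : ℕ} [NeZero X] {f : ℝ → ℝ} {p h : ℝ}
    (hf : Function.Periodic f p) (hX : (X : ℝ) * h = p) (i : ZMod X) (c : ℝ) :
    f (c + ((i - 1).val : ℝ) * h) = f (c + (i.val : ℝ) * h - h) := by
  obtain ⟨k, hk⟩ : (X : ℤ) ∣ ((i - 1).val : ℤ) - ((i.val : ℤ) - 1) := by
    rw [← ZMod.intCast_zmod_eq_zero_iff_dvd]
    simp
  have hk' : ((i - 1).val : ℝ) - ((i.val : ℝ) - 1) = X * k := by exact_mod_cast hk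
  rw [show c + ((i - 1).val : ℝ) * h = c + (i.val : ℝ) * h - h + k * p by
    rw [← hX]
    linear_combination h * hk']
  exact hf.int_mul k _

/-- Pointwise error of the upwind scheme: each step contributes at most `C1·Δx·Δt`. -/
lemma abs_upwind_sub_le {X M : ℕ} [NeZero X] {Δx Δt : ℝ} (hΔx : 0 < Δx) (hΔt : 0 < Δt)
    (hXΔx : (X : ℝ) * Δx = 2) {u0 : ℝ → ℝ} {C1 : ℝ} (hsmooth : ContDiff ℝ 2 u0)
    (hper : ∀ y, u0 (y + 2) = u0 y) (hC1 : ∀ y, |deriv (deriv u0) y| ≤ C1)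
    {a : ℕ → ℝ} (ha : ∀ n < M, 0 < a n ∧ a n ≤ 2) (hcfl : ∀ n < M, a n * Δt ≤ Δx)
    (i : ZMod X) :
    |upwind (fun n => a n * Δt / Δx) (fun i => u0 (-1 + (i.val : ℝ) * Δx)) M i -
      u0 ((-1 + (i.val : ℝ) * Δx) - Δt * ∑ j ∈ range M, a j)| ≤ M * (C1 * Δx * Δt) := by
  induction M generalizing i with
  | zero => simp [upwind]
  | succ n ih =>
    replace ih := ih (fun m hm => ha m (by omega)) (fun m hm => hcfl m (by omega))
    obtain ⟨ha0, ha2⟩ := ha n n.lt_succ_self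
    have hcfl := hcfl n n.lt_succ_self
    have hC0 : 0 ≤ C1 := (abs_nonneg _).trans (hC1 0)
    have hl0 : 0 ≤ a n * Δt / Δx := by positivity
    have hl1 : a n * Δt / Δx ≤ 1 := (div_le_one hΔx).2 hcfl
    have hlx : a n * Δt / Δx * Δx = a n * Δt := div_mul_cancel₀ _ hΔx.ne'
    simp only [upwind]
    have e₁ := ih i
    have e₂ := ih (i - 1)
    set S := ∑ j ∈ range n, a j with hS
    have hshift : u0 (-1 + ((i - 1).val : ℝ) * Δx - Δt * S) =
        u0 (-1 + (i.val : ℝ) * Δx - Δt * S - Δx) := by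
      have := Function.Periodic.apply_grid_sub_one hper hXΔx i (-1 - Δt * S)
      convert this using 2 <;> ring
    rw [hshift] at e₂
    have e₃ := abs_interpolation_sub_le hsmooth hC1 hl0 hl1
      (-1 + (i.val : ℝ) * Δx - Δt * S) Δx
    rw [hlx, sub_sub _ _ (a n * Δt)] at e₃
    rw [sum_range_succ, ← hS, mul_add, mul_comm Δt (a n)]
    generalize a n * Δt / Δx = l at *
    have hb : C1 / 2 * (l * (1 - l) * Δx ^ 2) ≤ C1 * Δx * Δt := by
      have hlΔ : l * (1 - l) * Δx ^ 2 ≤ 2 * (Δx * Δt) :=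
        calc l * (1 - l) * Δx ^ 2 = (1 - l) * (a n * Δt * Δx) := by rw [← hlx]; ring
          _ ≤ 1 * (2 * Δt * Δx) := by gcongr; linarith
          _ = 2 * (Δx * Δt) := by ring
      calc C1 / 2 * (l * (1 - l) * Δx ^ 2) ≤ C1 / 2 * (2 * (Δx * Δt)) := by gcongr
        _ = C1 * Δx * Δt := by ring
    rw [abs_le] at e₁ e₂ e₃ ⊢
    have hl1' : 0 ≤ 1 - l := sub_nonneg.2 hl1
    push_cast
    constructor
    · linarith [mul_le_mul_of_nonneg_left e₁.1 hl1', mul_le_mul_of_nonneg_left e₂.1 hl0]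
    · linarith [mul_le_mul_of_nonneg_left e₁.2 hl1', mul_le_mul_of_nonneg_left e₂.2 hl0]

/-- A uniform bound `|f i| ≤ B` gives the `ℓ²` bound `√(card ι) * B`. -/
lemma sqrt_sum_sq_le {ι : Type*} [Fintype ι] {f : ι → ℝ} {B : ℝ} (hB : 0 ≤ B)
    (hf : ∀ i, |f i| ≤ B) : √(∑ i, f i ^ 2) ≤ √(Fintype.card ι) * B := by
  rw [← Real.sqrt_sq hB, ← Real.sqrt_mul (Nat.cast_nonneg _)]
  refine Real.sqrt_le_sqrt ?_
  calc ∑ i, f i ^ 2 ≤ ∑ _i : ι, B ^ 2 :=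
        sum_le_sum fun i _ => sq_le_sq' (abs_le.1 (hf i)).1 (abs_le.1 (hf i)).2
    _ = Fintype.card ι * B ^ 2 := by simp

/-- **Global ℓ² convergence of the upwind scheme with time-dependent velocity**
(estimate (3.19)): if `u0` is 2-periodic and `C²` with `sup|u0''| ≤ C1`, the per-step
velocities satisfy `0 < a_n ≤ 2` and the CFL condition `a_n·Δt ≤ Δx`, then the upwind
solution `v^M` at time `T = M·Δt` satisfies
`‖v^M − u(·, T)‖_{ℓ²} ≤ (2 + 1/κ)·C1·T·√X·Δt`, where `u(x,T) = u0(x − Δt·∑_{j<M} a_j)`. -/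
theorem upwind_l2_convergence (X M : ℕ) [NeZero X] (hM : 1 ≤ M)
    (Δx Δt κ T : ℝ) (hΔx : 0 < Δx) (hΔt : 0 < Δt)
    (hXΔx : (X : ℝ) * Δx = 2) (hκ : κ = Δt / Δx) (hT : T = (M : ℝ) * Δt)
    (u0 : ℝ → ℝ) (C1 : ℝ) (hsmooth : ContDiff ℝ 2 u0)
    (hper : ∀ y, u0 (y + 2) = u0 y) (hC1 : ∀ y, |deriv (deriv u0) y| ≤ C1)
    (a : ℕ → ℝ) (ha : ∀ n < M, 0 < a n ∧ a n ≤ 2) (hcfl : ∀ n < M, a n * Δt ≤ Δx) :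
    Real.sqrt (∑ i : ZMod X,
        (upwind (fun n => a n * Δt / Δx) (fun i => u0 (-1 + (i.val : ℝ) * Δx)) M i -
          u0 ((-1 + (i.val : ℝ) * Δx) - Δt * ∑ j ∈ range M, a j)) ^ 2) ≤
      (2 + 1 / κ) * C1 * T * Real.sqrt X * Δt := by
  have hC0 : 0 ≤ C1 := (abs_nonneg _).trans (hC1 0)
  refine (sqrt_sum_sq_le (by positivity)
    (abs_upwind_sub_le hΔx hΔt hXΔx hsmooth hper hC1 ha hcfl)).trans ?_
  rw [ZMod.card, hT, hκ, one_div_div]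
  calc √(X : ℝ) * (M * (C1 * Δx * Δt))
      = Δx / Δt * C1 * (M * Δt) * √X * Δt := by field_simp
    _ ≤ (2 + Δx / Δt) * C1 * (M * Δt) * √X * Δt := by gcongr; linarith
end
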